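/- For every n ∈ ℤ and every x ∈ [2n, 2n+1], p(x) = n. In particular, on each even interval [2n, 2n+1] the function p agrees with x ↦ ⌊x/2⌋. -/

import Mathlib

noncomputable def parity (x : ℝ) : ℝ := max 0 (Real.pi / 2 * Real.sin (Real.pi * x))

noncomputable def pfun (x : ℝ) : ℝ := ∫ t in (0:ℝ)..(x - 1), parity t

theorem parity_continuous : Continuous parity := by
  unfold parity
  fun_prop

theorem parity_periodic : Function.Periodic parity 2 := by
  intro x
  have h : Real.pi * (x + 2) = Real.pi * x + 2 * Real.pi := by ring
  simp only [parity, h, Real.sin_add_two_pi]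

theorem parity_eq_zero_of_mem_Icc {t : ℝ} (ht : t ∈ Set.Icc (-1 : ℝ) 0) : parity t = 0 := by
  have hs : Real.sin (Real.pi * t) ≤ 0 :=
    Real.sin_nonpos_of_nonpos_of_neg_pi_le
      (mul_nonpos_of_nonneg_of_nonpos Real.pi_pos.le ht.2) (by nlinarith [Real.pi_pos, ht.1])
  exact max_eq_left (mul_nonpos_of_nonneg_of_nonpos (by positivity) hs)

theorem parity_eq_of_mem_Icc {t : ℝ} (ht : t ∈ Set.Icc (0 : ℝ) 1) :
    parity t = Real.pi / 2 * Real.sin (Real.pi * t) := by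
  have hs : 0 ≤ Real.sin (Real.pi * t) :=
    Real.sin_nonneg_of_nonneg_of_le_pi
      (mul_nonneg Real.pi_pos.le ht.1) (by nlinarith [Real.pi_pos, ht.2])
  exact max_eq_right (by positivity)

theorem integral_parity_zero_one : ∫ t in (0 : ℝ)..1, parity t = 1 := by
  have h : Set.EqOn parity (fun t => Real.pi / 2 * Real.sin (Real.pi * t)) (Set.uIcc 0 1) := by
    intro t ht
    rw [Set.uIcc_of_le zero_le_one] at ht
    exact parity_eq_of_mem_Icc ht
  rw [intervalIntegral.integral_congr h, intervalIntegral.integral_const_mul,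
    intervalIntegral.integral_comp_mul_left _ Real.pi_ne_zero]
  simp only [mul_zero, mul_one, integral_sin, Real.cos_zero, Real.cos_pi, smul_eq_mul]
  field_simp
  norm_num

theorem integral_parity_eq_zero {a : ℝ} (ha : a ∈ Set.Icc (-1 : ℝ) 0) :
    ∫ t in (0 : ℝ)..a, parity t = 0 := by
  have h : Set.EqOn parity (fun _ => 0) (Set.uIcc 0 a) := by
    intro t ht
    rw [Set.uIcc_of_ge ha.2] at ht
    exact parity_eq_zero_of_mem_Icc ⟨ha.1.trans ht.1, ht.2⟩
  rw [intervalIntegral.integral_congr h, intervalIntegral.integral_zero]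

theorem integral_parity_period : ∫ t in (0 : ℝ)..2, parity t = 1 := by
  have hi (a b : ℝ) : IntervalIntegrable parity MeasureTheory.volume a b :=
    parity_continuous.intervalIntegrable a b
  have h := parity_periodic.intervalIntegral_add_eq 0 (-1)
  have h' := intervalIntegral.integral_add_adjacent_intervals (hi (-1) 0) (hi 0 1)
  rw [intervalIntegral.integral_symm, integral_parity_eq_zero (by norm_num),
    integral_parity_zero_one] at h'
  norm_num at h h'
  rw [h, ← h']

theorem pfun_add_two_mul_int (x : ℝ) (n : ℤ) : pfun (x + 2 * n) = pfun x + n := by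
  have h := parity_periodic.intervalIntegral_add_zsmul_eq n (x - 1)
    (fun a b => parity_continuous.intervalIntegrable a b)
  have h2 := parity_periodic.intervalIntegral_add_eq (x - 1) 0
  rw [zero_add, integral_parity_period] at h2
  have e : x - 1 + n • (2 : ℝ) = x + 2 * n - 1 := by
    rw [zsmul_eq_mul]
    ring
  rw [h2, e, zsmul_eq_mul, mul_one] at h
  have hi (a b : ℝ) : IntervalIntegrable parity MeasureTheory.volume a b :=
    parity_continuous.intervalIntegrable a b
  rw [pfun, pfun, ← intervalIntegral.integral_add_adjacent_intervals (hi 0 (x - 1)) (hi _ _), h]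

theorem pfun_eq_on_even_interval (n : ℤ) :
    ∀ x ∈ Set.Icc ((2*n : ℝ)) (2*n + 1), pfun x = n ∧ pfun x = (⌊x / 2⌋ : ℤ) := by
  intro x hx
  obtain ⟨h₁, h₂⟩ := hx
  have hp : pfun x = n := by
    have h := pfun_add_two_mul_int (x - 2 * n) n
    have h0 : pfun (x - 2 * n) = 0 :=
      integral_parity_eq_zero ⟨by linarith, by linarith⟩
    rwa [sub_add_cancel, h0, zero_add] at h
  have hf : ⌊x / 2⌋ = n := Int.floor_eq_iff.mpr ⟨by linarith, by linarith⟩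
  exact ⟨hp, by rw [hp, hf]⟩
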